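/- Let G be a finite group, p a prime, and N a normal p'-subgroup of G (i.e., p does not divide |N|). Then the number of conjugacy classes of p-elements of G equals the number of conjugacy classes of p-elements of G/N. -/

import Mathlib

/-- The number of conjugacy classes of `p`-elements of `G`. -/
noncomputable def kp (p : ℕ) (G : Type*) [Group G] : ℕ :=
  Nat.card {c : ConjClasses G // ∀ g ∈ c.carrier, ∃ n : ℕ, orderOf g = p ^ n}

/-- An element of `p`-power order in a subgroup of order prime to `p` is trivial. -/
theorem eq_one_of_mem_of_pow_prime_pow_eq_one {G : Type*} [Group G] {p : ℕ} (hp : p.Prime)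
    {N : Subgroup G} (hN : ¬ p ∣ Nat.card N) {g : G} (hg : g ∈ N) {n : ℕ}
    (hgn : g ^ p ^ n = 1) : g = 1 := by
  rw [← orderOf_eq_one_iff]
  exact Nat.eq_one_of_dvd_coprimes (((hp.coprime_iff_not_dvd).2 hN).pow_left n)
    (orderOf_dvd_of_pow_eq_one hgn) (N.orderOf_dvd_natCard hg)

/-- In a finite group, an element with trivial `p ^ n`-th power modulo `N` is congruent modulo `N`
to an element of `p`-power order. -/
theorem exists_pElement_mk_eq {G : Type*} [Group G] [Finite G] {p : ℕ} (hp : p.Prime)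
    (N : Subgroup G) [N.Normal] (x : G) {n : ℕ} (hx : (x : G ⧸ N) ^ p ^ n = 1) :
    ∃ y : G, (∃ a : ℕ, orderOf y = p ^ a) ∧ (y : G ⧸ N) = x := by
  obtain ⟨a, m, hm, hxm⟩ :=
    Nat.exists_eq_pow_mul_and_not_dvd (orderOf_pos x).ne' p hp.ne_one
  obtain ⟨k, hk0, hk1⟩ :=
    Nat.chineseRemainder (((hp.coprime_iff_not_dvd).2 hm).symm.pow_right n) 0 1
  obtain ⟨c, rfl⟩ := (Nat.modEq_zero_iff_dvd).1 hk0
  refine ⟨x ^ (m * c), ?_, ?_⟩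
  · have hpow : (x ^ (m * c)) ^ p ^ a = 1 := by
      rw [← pow_mul, show m * c * p ^ a = p ^ a * m * c by ring, ← hxm, pow_mul,
        pow_orderOf_eq_one, one_pow]
    obtain ⟨b, -, hb⟩ := (Nat.dvd_prime_pow hp).1 (orderOf_dvd_of_pow_eq_one hpow)
    exact ⟨b, hb⟩
  · rw [QuotientGroup.mk_pow]
    conv_rhs => rw [← pow_one (x : G ⧸ N)]
    exact pow_eq_pow_iff_modEq.2 (hk1.of_dvd (orderOf_dvd_of_pow_eq_one hx))

/-- Two elements of `p`-power order that are congruent modulo a normal subgroup of order prime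
to `p` are conjugate. -/
theorem isConj_of_mk_eq {G : Type*} [Group G] [Finite G] {p : ℕ} [Fact p.Prime]
    (N : Subgroup G) [N.Normal] (hN : ¬ p ∣ Nat.card N) {x y : G}
    (hx : ∃ n : ℕ, orderOf x = p ^ n) (hy : ∃ n : ℕ, orderOf y = p ^ n)
    (hxy : (x : G ⧸ N) = y) : IsConj x y := by
  let H : Subgroup G := (Subgroup.zpowers (x : G ⧸ N)).comap (QuotientGroup.mk' N)
  have exists_sylow (z : H) (hz : ∃ n : ℕ, orderOf (z : G) = p ^ n) :
      ∃ P : Sylow p H, z ∈ P := by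
    obtain ⟨n, hn⟩ := hz
    have hz' : IsPGroup p (Subgroup.zpowers z) :=
      IsPGroup.of_card (n := n) (by rw [Nat.card_zpowers, ← Subgroup.orderOf_coe, hn])
    obtain ⟨P, hP⟩ := hz'.exists_le_sylow
    exact ⟨P, hP (Subgroup.mem_zpowers z)⟩
  have hxH : x ∈ H := Subgroup.mem_zpowers (x : G ⧸ N)
  have hyH : y ∈ H := by
    change (y : G ⧸ N) ∈ Subgroup.zpowers (x : G ⧸ N)
    exact hxy ▸ Subgroup.mem_zpowers _
  obtain ⟨P, hP⟩ := exists_sylow ⟨x, hxH⟩ hx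
  obtain ⟨Q, hQ⟩ := exists_sylow ⟨y, hyH⟩ hy
  obtain ⟨h, rfl⟩ := MulAction.exists_smul_eq H P Q
  have hconj : h * ⟨x, hxH⟩ * h⁻¹ ∈ h • P :=
    Subgroup.smul_mem_pointwise_smul _ (MulAut.conj h) (P : Subgroup H) hP
  obtain ⟨n, hn⟩ := (h • P).isPGroup' ⟨_, mul_mem hconj (inv_mem hQ)⟩
  have hpow : ((h : G) * x * (h : G)⁻¹ * y⁻¹) ^ p ^ n = 1 := by
    simpa using congrArg (fun z : (h • P : Sylow p H) => ((z : H) : G)) hn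
  have hmem : (h : G) * x * (h : G)⁻¹ * y⁻¹ ∈ N := by
    obtain ⟨k, hk⟩ := Subgroup.mem_zpowers_iff.1 (show ((h : G) : G ⧸ N) ∈ _ from h.2)
    rw [← QuotientGroup.eq_one_iff]
    simp only [QuotientGroup.mk_mul, QuotientGroup.mk_inv, ← hk, ← hxy]
    group
  exact isConj_iff.2 ⟨h, mul_inv_eq_one.1
    (eq_one_of_mem_of_pow_prime_pow_eq_one Fact.out hN hmem hpow)⟩

/-- A conjugacy class consists of `p`-elements as soon as one representative is a `p`-element. -/
theorem ConjClasses.forall_mem_carrier_mk_orderOf {G : Type*} [Group G] {p : ℕ} {x : G} :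
    (∀ g ∈ (ConjClasses.mk x).carrier, ∃ n : ℕ, orderOf g = p ^ n) ↔
      ∃ n : ℕ, orderOf x = p ^ n := by
  refine ⟨fun h => h x ConjClasses.mem_carrier_mk, fun h g hg => ?_⟩
  obtain ⟨c, hc⟩ := ConjClasses.mk_eq_mk_iff_isConj.1 (ConjClasses.mem_carrier_iff_mk_eq.1 hg)
  rwa [hc.orderOf_eq]

theorem stmt_5 {G : Type*} [Group G] [Finite G] (p : ℕ) [Fact p.Prime]
    (N : Subgroup G) [N.Normal] (hN : ¬ p ∣ Nat.card N) :
    kp p G = kp p (G ⧸ N) := by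
  have hp : p.Prime := Fact.out
  refine Nat.card_congr (Equiv.ofBijective
    (Subtype.map (ConjClasses.map (QuotientGroup.mk' N)) fun c => ?_) ⟨?_, ?_⟩)
  · obtain ⟨x, rfl⟩ := ConjClasses.mk_surjective c
    intro hx
    obtain ⟨n, hn⟩ := ConjClasses.forall_mem_carrier_mk_orderOf.1 hx
    obtain ⟨m, -, hm⟩ := (Nat.dvd_prime_pow hp).1 (hn ▸ orderOf_map_dvd (QuotientGroup.mk' N) x)
    exact ConjClasses.forall_mem_carrier_mk_orderOf.2 ⟨m, hm⟩
  · rintro ⟨c, hc⟩ ⟨d, hd⟩ hcd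
    obtain ⟨x, rfl⟩ := ConjClasses.mk_surjective c
    obtain ⟨y, rfl⟩ := ConjClasses.mk_surjective d
    rw [ConjClasses.forall_mem_carrier_mk_orderOf] at hc hd
    have hxy : IsConj (x : G ⧸ N) (y : G ⧸ N) :=
      ConjClasses.mk_eq_mk_iff_isConj.1 (congrArg Subtype.val hcd)
    obtain ⟨q, hq⟩ := isConj_iff.1 hxy
    obtain ⟨g, rfl⟩ := QuotientGroup.mk_surjective q
    have hg : IsConj x (g * x * g⁻¹) := isConj_iff.2 ⟨g, rfl⟩
    rw [(SemiconjBy.conj_mk g x).orderOf_eq] at hc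
    exact Subtype.ext (ConjClasses.mk_eq_mk_iff_isConj.2
      (hg.trans (isConj_of_mk_eq N hN hc hd hq)))
  · rintro ⟨c, hc⟩
    obtain ⟨q, rfl⟩ := ConjClasses.mk_surjective c
    obtain ⟨x, rfl⟩ := QuotientGroup.mk_surjective q
    obtain ⟨n, hn⟩ := ConjClasses.forall_mem_carrier_mk_orderOf.1 hc
    obtain ⟨y, hy, hyx⟩ := exists_pElement_mk_eq hp N x (hn ▸ pow_orderOf_eq_one (x : G ⧸ N))
    exact ⟨⟨ConjClasses.mk y, ConjClasses.forall_mem_carrier_mk_orderOf.2 hy⟩,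
      Subtype.ext (congrArg ConjClasses.mk hyx)⟩
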